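/- Every conformal transformation of ℝ^{2n} (n ≥ 2, so dimension ≥ 4 ≥ 3) defined on a connected open set, i.e. a smooth map whose differential at each point is a nonzero scalar multiple of an orthogonal matrix, is the restriction of a Möbius transformation: a composition of translations, rotations, dilations, and at most one inversion x ↦ x/|x|². (Liouville's theorem on conformal maps.) -/

import Mathlib

section Liouville

open InnerProductSpace

theorem exists_orthonormal_pair_orthogonal {E : Type*} [NormedAddCommGroup E]
    [InnerProductSpace ℝ E] [FiniteDimensional ℝ E] (hdim : 3 ≤ Module.finrank ℝ E) (y : E) :
    ∃ z t : E, ⟪z, z⟫_ℝ = 1 ∧ ⟪t, t⟫_ℝ = 1 ∧ ⟪z, t⟫_ℝ = 0 ∧ ⟪y, z⟫_ℝ = 0 ∧ ⟪y, t⟫_ℝ = 0 := by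
  have hsum := Submodule.finrank_add_finrank_orthogonal (ℝ ∙ y)
  have hspan : Module.finrank ℝ (ℝ ∙ y) ≤ 1 := by
    simpa using finrank_span_le_card (R := ℝ) ({y} : Set E)
  have horth : 2 ≤ Module.finrank ℝ (ℝ ∙ y)ᗮ := by omega
  let b := stdOrthonormalBasis ℝ (ℝ ∙ y)ᗮ
  have hb := orthonormal_iff_ite.mp b.orthonormal
  have hy (i) : ⟪y, (b i : E)⟫_ℝ = 0 :=
    Submodule.mem_orthogonal_singleton_iff_inner_right.mp (b i).2
  refine ⟨b ⟨0, by omega⟩, b ⟨1, by omega⟩, ?_, ?_, ?_, hy _, hy _⟩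
  · exact (hb ⟨0, by omega⟩ ⟨0, by omega⟩).trans (if_pos rfl)
  · exact (hb ⟨1, by omega⟩ ⟨1, by omega⟩).trans (if_pos rfl)
  · exact (hb ⟨0, by omega⟩ ⟨1, by omega⟩).trans (if_neg (by simp))

/-- A field of endomorphisms whose Kulkarni–Nomizu product with the metric vanishes is zero in
dimension at least three. -/
theorem eq_zero_of_curvature_eq_zero {E : Type*} [NormedAddCommGroup E]
    [InnerProductSpace ℝ E] [FiniteDimensional ℝ E] (hdim : 3 ≤ Module.finrank ℝ E) (S : E → E)
    (hS : ∀ y z u, (⟪S y, z⟫_ℝ - ⟪S z, y⟫_ℝ) • u + ⟪S y, u⟫_ℝ • z - ⟪S z, u⟫_ℝ • y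
      - ⟪z, u⟫_ℝ • S y + ⟪y, u⟫_ℝ • S z = 0) (y : E) : S y = 0 := by
  have key (y z : E) (hz : ⟪z, z⟫_ℝ = 1) (hyz : ⟪y, z⟫_ℝ = 0) :
      S y = ⟪S y, z⟫_ℝ • z - ⟪S z, z⟫_ℝ • y := by
    have h := hS y z z
    have h' := congrArg (fun v => ⟪v, z⟫_ℝ) h
    simp only [inner_add_left, inner_sub_left, inner_smul_left, hz, hyz, inner_zero_left,
      conj_trivial] at h'
    have hsymm : ⟪S z, y⟫_ℝ = ⟪S y, z⟫_ℝ := by linarith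
    rw [hsymm, hz, hyz] at h
    linear_combination (norm := module) -h
  obtain ⟨z, t, hz, ht, hzt, hyz, hyt⟩ := exists_orthonormal_pair_orthogonal hdim y
  have htz : ⟪t, z⟫_ℝ = 0 := (real_inner_comm z t).trans hzt
  have hzy : ⟪z, y⟫_ℝ = 0 := (real_inner_comm y z).trans hyz
  have hty : ⟪t, y⟫_ℝ = 0 := (real_inner_comm y t).trans hyt
  have e₁ := key y z hz hyz
  have e₂ := key y t ht hyt
  have e₃ := key z t ht hzt
  have hzz : ⟪S z, z⟫_ℝ = -⟪S t, t⟫_ℝ := by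
    have h := congrArg (fun v => ⟪v, z⟫_ℝ) e₃
    simp only [inner_sub_left, inner_smul_left, hz, htz, conj_trivial] at h
    linarith
  have hz0 : ⟪S z, z⟫_ℝ • y = 0 := by
    by_cases hy : y = 0
    · simp [hy]
    have hyy : ⟪y, y⟫_ℝ ≠ 0 := by simpa using hy
    have h₁ := congrArg (fun v => ⟪v, y⟫_ℝ) e₁
    have h₂ := congrArg (fun v => ⟪v, y⟫_ℝ) e₂
    simp only [inner_sub_left, inner_smul_left, hzy, hty, conj_trivial] at h₁ h₂
    have h0 : ⟪S z, z⟫_ℝ * ⟪y, y⟫_ℝ = 0 := by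
      have : ⟪S t, t⟫_ℝ = -⟪S z, z⟫_ℝ := by linarith
      rw [this] at h₂
      linarith
    simp [(mul_eq_zero.mp h0).resolve_right hyy]
  have ht0 : ⟪S t, t⟫_ℝ • y = 0 := by
    rw [show ⟪S t, t⟫_ℝ = -⟪S z, z⟫_ℝ by linarith, neg_smul, hz0, neg_zero]
  rw [hz0, sub_zero] at e₁
  rw [ht0, sub_zero] at e₂
  have h := congrArg (fun v => ⟪v, z⟫_ℝ) e₂
  simp only [inner_smul_left, htz, mul_zero] at h
  rw [e₁, h, zero_smul]

/-- The difference of the Levi-Civita connections of the metrics `exp (2 * φ) • g` and `g` on a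
Euclidean space, where `w` is the gradient of `φ`. -/
def conformalConnection {E : Type*} [NormedAddCommGroup E] [InnerProductSpace ℝ E] (w u v : E) :
    E :=
  ⟪w, u⟫_ℝ • v + ⟪w, v⟫_ℝ • u - ⟪u, v⟫_ℝ • w

/-- Half the logarithmic gradient of the squared conformal factor `‖Df e‖ ^ 2`. -/
noncomputable def logConformalGradient {E : Type*} [NormedAddCommGroup E] [InnerProductSpace ℝ E]
    [CompleteSpace E] (f : E → E) (e x : E) : E :=
  (2 * ⟪fderiv ℝ f x e, fderiv ℝ f x e⟫_ℝ)⁻¹ •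
    (toDual ℝ E).symm (fderiv ℝ (fun x => ⟪fderiv ℝ f x e, fderiv ℝ f x e⟫_ℝ) x)

theorem ContDiffAt.fderiv_infty {E F : Type*} [NormedAddCommGroup E] [NormedSpace ℝ E]
    [NormedAddCommGroup F] [NormedSpace ℝ F] {f : E → F} {x : E}
    (hf : ContDiffAt ℝ (⊤ : ℕ∞) f x) : ContDiffAt ℝ (⊤ : ℕ∞) (fderiv ℝ f) x :=
  hf.fderiv_right (by simp)

theorem ContDiffAt.isSymmSndFDerivAt_infty {E F : Type*} [NormedAddCommGroup E] [NormedSpace ℝ E]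
    [NormedAddCommGroup F] [NormedSpace ℝ F] {f : E → F} {x : E}
    (hf : ContDiffAt ℝ (⊤ : ℕ∞) f x) : IsSymmSndFDerivAt ℝ f x :=
  hf.isSymmSndFDerivAt (by
    rw [minSmoothness_of_isRCLikeNormedField]
    exact WithTop.coe_le_coe.mpr (le_top : (2 : ℕ∞) ≤ ⊤))

theorem inner_fderiv_fderiv_of_conformalAt {E : Type*} [NormedAddCommGroup E]
    [InnerProductSpace ℝ E] {f : E → E} {x e : E} (he : ‖e‖ = 1) (h : ConformalAt f x) (u v : E) :
    ⟪fderiv ℝ f x u, fderiv ℝ f x v⟫_ℝ = ⟪fderiv ℝ f x e, fderiv ℝ f x e⟫_ℝ * ⟪u, v⟫_ℝ := by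
  obtain ⟨c, -, hc⟩ := conformalAt_iff'.mp h
  rw [hc, hc, real_inner_self_eq_norm_sq, he]
  ring

theorem inner_fderiv_self_pos_of_conformalAt {E : Type*} [NormedAddCommGroup E]
    [InnerProductSpace ℝ E] {f : E → E} {x e : E} (he : ‖e‖ = 1) (h : ConformalAt f x) :
    0 < ⟪fderiv ℝ f x e, fderiv ℝ f x e⟫_ℝ := by
  obtain ⟨c, hc0, hc⟩ := conformalAt_iff'.mp h
  rw [hc, real_inner_self_eq_norm_sq, he]
  simpa using hc0

theorem fderiv_injective_of_conformalAt {E : Type*} [NormedAddCommGroup E]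
    [InnerProductSpace ℝ E] {f : E → E} {x : E} (h : ConformalAt f x) :
    Function.Injective (fderiv ℝ f x) := by
  obtain ⟨c, hc0, hc⟩ := conformalAt_iff'.mp h
  refine (injective_iff_map_eq_zero _).mpr fun v hv => ?_
  have := hc v v
  rw [hv, inner_zero_left] at this
  simpa [hc0.ne'] using this.symm

theorem contDiffAt_logConformalGradient {E : Type*} [NormedAddCommGroup E] [InnerProductSpace ℝ E]
    [CompleteSpace E] {f : E → E} {e x : E} (he : ‖e‖ = 1) (hf : ContDiffAt ℝ (⊤ : ℕ∞) f x)
    (hc : ConformalAt f x) : ContDiffAt ℝ (⊤ : ℕ∞) (logConformalGradient f e) x := by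
  have hFe : ContDiffAt ℝ (⊤ : ℕ∞) (fun x => fderiv ℝ f x e) x :=
    hf.fderiv_infty.clm_apply contDiffAt_const
  have hq := hFe.inner ℝ hFe
  refine ContDiffAt.smul (ContDiffAt.inv (contDiffAt_const.mul hq) ?_) ?_
  · exact mul_ne_zero two_ne_zero (inner_fderiv_self_pos_of_conformalAt he hc).ne'
  · exact (toDual ℝ E).symm.contDiff.contDiffAt.comp x hq.fderiv_infty

theorem fderiv_fderiv_of_conformal {E : Type*} [NormedAddCommGroup E] [InnerProductSpace ℝ E]
    [FiniteDimensional ℝ E] {f : E → E} {e x : E} {U : Set E} (hU : IsOpen U) (he : ‖e‖ = 1)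
    (hf : ContDiffOn ℝ (⊤ : ℕ∞) f U) (hc : ∀ x ∈ U, ConformalAt f x) (hx : x ∈ U) (u v : E) :
    fderiv ℝ (fderiv ℝ f) x u v =
      fderiv ℝ f x (conformalConnection (logConformalGradient f e x) u v) := by
  have hfx := hf.contDiffAt (hU.mem_nhds hx)
  have hF : DifferentiableAt ℝ (fderiv ℝ f) x := hfx.fderiv_infty.differentiableAt (by simp)
  have happ (v : E) : HasFDerivAt (fun x => fderiv ℝ f x v) ((fderiv ℝ (fderiv ℝ f) x).flip v) x := by
    simpa using hF.hasFDerivAt.clm_apply (hasFDerivAt_const v x)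
  set w := logConformalGradient f e x with hw
  set q : E → ℝ := fun x => ⟪fderiv ℝ f x e, fderiv ℝ f x e⟫_ℝ
  have hqpos : 0 < q x := inner_fderiv_self_pos_of_conformalAt he (hc x hx)
  have hqd : DifferentiableAt ℝ q x := ((happ e).inner ℝ (happ e)).differentiableAt
  have hwq (z : E) : fderiv ℝ q x z = 2 * q x * ⟪w, z⟫_ℝ := by
    rw [hw, logConformalGradient, inner_smul_left, toDual_symm_apply]
    change _ = 2 * q x * ((2 * q x)⁻¹ * fderiv ℝ q x z)
    field_simp
  have hprod (z u v : E) : ⟪fderiv ℝ (fderiv ℝ f) x z u, fderiv ℝ f x v⟫_ℝ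
      + ⟪fderiv ℝ (fderiv ℝ f) x z v, fderiv ℝ f x u⟫_ℝ = 2 * q x * ⟪w, z⟫_ℝ * ⟪u, v⟫_ℝ := by
    have h₁ := (happ u).inner ℝ (happ v)
    have h₂ := hqd.hasFDerivAt.mul_const (⟪u, v⟫_ℝ)
    have heq : (fun x => ⟪fderiv ℝ f x u, fderiv ℝ f x v⟫_ℝ) =ᶠ[nhds x] fun x => q x * ⟪u, v⟫_ℝ := by
      filter_upwards [hU.mem_nhds hx] with y hy
      exact inner_fderiv_fderiv_of_conformalAt he (hc y hy) u v
    have h := DFunLike.congr_fun (h₁.unique (h₂.congr_of_eventuallyEq heq)) z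
    simp only [ContinuousLinearMap.comp_apply, ContinuousLinearMap.prod_apply,
      fderivInnerCLM_apply, ContinuousLinearMap.flip_apply, smul_apply, smul_eq_mul, hwq] at h
    rw [real_inner_comm] at h
    linarith
  have hsymm (a b : E) : fderiv ℝ (fderiv ℝ f) x a b = fderiv ℝ (fderiv ℝ f) x b a :=
    hfx.isSymmSndFDerivAt_infty a b
  have hkoszul (z : E) : ⟪fderiv ℝ (fderiv ℝ f) x u v, fderiv ℝ f x z⟫_ℝ =
      ⟪fderiv ℝ f x (conformalConnection w u v), fderiv ℝ f x z⟫_ℝ := by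
    rw [inner_fderiv_fderiv_of_conformalAt he (hc x hx)]
    change _ = q x * _
    simp only [conformalConnection, inner_add_left, inner_sub_left, inner_smul_left, conj_trivial]
    have h₁ := hprod u v z
    have h₂ := hprod v u z
    have h₃ := hprod z u v
    rw [hsymm v u] at h₂
    rw [hsymm z u, hsymm z v] at h₃
    linarith
  have hsurj : Function.Surjective (fderiv ℝ f x) :=
    (fderiv ℝ f x : E →ₗ[ℝ] E).surjective_of_injective
      (fderiv_injective_of_conformalAt (hc x hx))
  refine ext_inner_right ℝ fun y => ?_
  obtain ⟨z, rfl⟩ := hsurj y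
  exact hkoszul z

theorem fderiv_logConformalGradient {E : Type*} [NormedAddCommGroup E] [InnerProductSpace ℝ E]
    [FiniteDimensional ℝ E] (hdim : 3 ≤ Module.finrank ℝ E) {f : E → E} {e x : E} {U : Set E}
    (hU : IsOpen U) (he : ‖e‖ = 1) (hf : ContDiffOn ℝ (⊤ : ℕ∞) f U)
    (hc : ∀ x ∈ U, ConformalAt f x) (hx : x ∈ U) (y : E) :
    fderiv ℝ (logConformalGradient f e) x y =
      ⟪logConformalGradient f e x, y⟫_ℝ • logConformalGradient f e x
        - (‖logConformalGradient f e x‖ ^ 2 / 2) • y := by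
  have hfx := hf.contDiffAt (hU.mem_nhds hx)
  have hF : DifferentiableAt ℝ (fderiv ℝ f) x := hfx.fderiv_infty.differentiableAt (by simp)
  have hw := ((contDiffAt_logConformalGradient he hfx (hc x hx)).differentiableAt
    (by simp)).hasFDerivAt
  set w := logConformalGradient f e
  set H := fderiv ℝ w x
  have hthird (y z u : E) : fderiv ℝ (fderiv ℝ fun x => fderiv ℝ f x u) x y z =
      fderiv ℝ f x (conformalConnection (w x) y (conformalConnection (w x) z u) +
        (⟪H y, z⟫_ℝ • u + ⟪H y, u⟫_ℝ • z - ⟪z, u⟫_ℝ • H y)) := by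
    have hG : ContDiffAt ℝ (⊤ : ℕ∞) (fun x => fderiv ℝ f x u) x :=
      hfx.fderiv_infty.clm_apply contDiffAt_const
    have h₁ := (hG.fderiv_infty.differentiableAt (by simp)).hasFDerivAt.clm_apply
      (hasFDerivAt_const z x)
    have hΓ := (((hw.inner ℝ (hasFDerivAt_const z x)).smul_const u).add
      ((hw.inner ℝ (hasFDerivAt_const u x)).smul_const z)).sub (hw.const_smul ⟪z, u⟫_ℝ)
    have h₂ := hF.hasFDerivAt.clm_apply hΓ
    have heq : (fun x => fderiv ℝ (fun x => fderiv ℝ f x u) x z) =ᶠ[nhds x]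
        fun x => fderiv ℝ f x (conformalConnection (w x) z u) := by
      filter_upwards [hU.mem_nhds hx] with p hp
      have hFp : DifferentiableAt ℝ (fderiv ℝ f) p :=
        (hf.contDiffAt (hU.mem_nhds hp)).fderiv_infty.differentiableAt (by simp)
      rw [fderiv_clm_apply hFp (differentiableAt_const u),
        ← fderiv_fderiv_of_conformal hU he hf hc hp]
      simp
    have h := DFunLike.congr_fun (h₁.unique (h₂.congr_of_eventuallyEq heq)) y
    simp only [ContinuousLinearMap.comp_apply, ContinuousLinearMap.prod_apply, add_apply, sub_apply,
      fderivInnerCLM_apply, ContinuousLinearMap.flip_apply, smul_apply, zero_apply, map_zero,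
      ContinuousLinearMap.smulRight_apply, inner_zero_right, zero_add] at h
    rw [h, map_add, ← fderiv_fderiv_of_conformal hU he hf hc hx, add_comm]
    rfl
  have hS := eq_zero_of_curvature_eq_zero hdim
    (fun y => H y - ⟪w x, y⟫_ℝ • w x + (‖w x‖ ^ 2 / 2) • y) (fun y z u => by
      have hG : ContDiffAt ℝ (⊤ : ℕ∞) (fun x => fderiv ℝ f x u) x :=
        hfx.fderiv_infty.clm_apply contDiffAt_const
      have h := hG.isSymmSndFDerivAt_infty y z
      rw [hthird, hthird] at h
      have h' := fderiv_injective_of_conformalAt (hc x hx) h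
      simp only [conformalConnection, inner_add_left, inner_sub_left, inner_smul_left,
        inner_add_right, inner_sub_right, inner_smul_right, real_inner_self_eq_norm_sq,
        conj_trivial, real_inner_comm (w x), real_inner_comm y z] at h' ⊢
      linear_combination (norm := module) h') y
  linear_combination (norm := module) hS

theorem IsConformalMap.exists_linearIsometryEquiv {E : Type*} [NormedAddCommGroup E]
    [InnerProductSpace ℝ E] [FiniteDimensional ℝ E] {B : E →L[ℝ] E} (hB : IsConformalMap B) :
    ∃ α : ℝ, α ≠ 0 ∧ ∃ A : E ≃ₗᵢ[ℝ] E, ∀ v, B v = α • A v := by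
  obtain ⟨α, hα, A, rfl⟩ := hB
  exact ⟨α, hα, A.toLinearIsometryEquiv rfl, fun v => rfl⟩

/-- A field solving the flat Schouten equation on a connected open set is zero, or is the
logarithmic gradient of `‖x - a‖ ^ (-2)`. -/
theorem eq_zero_or_exists_center {E : Type*} [NormedAddCommGroup E] [InnerProductSpace ℝ E]
    {U : Set E} (hU : IsOpen U) (hconn : IsPreconnected U) {w : E → E}
    (hw : ∀ x ∈ U, DifferentiableAt ℝ w x)
    (hw' : ∀ x ∈ U, ∀ y, fderiv ℝ w x y = ⟪w x, y⟫_ℝ • w x - (‖w x‖ ^ 2 / 2) • y) :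
    (∀ x ∈ U, w x = 0) ∨ ∃ a ∉ U, ∀ x ∈ U, ‖x - a‖ ^ 2 • w x = (-2 : ℝ) • (x - a) := by
  by_cases h0 : ∀ x ∈ U, w x = 0
  · exact Or.inl h0
  right
  push Not at h0
  obtain ⟨x₀, hx₀, hwx₀⟩ := h0
  let c : E → E := fun x => x + (2 * (‖w x‖ ^ 2)⁻¹) • w x
  have hcont : ContinuousOn w U := fun x hx => (hw x hx).continuousAt.continuousWithinAt
  let N : Set E := U ∩ w ⁻¹' {0}ᶜ
  have hN : IsOpen N := hcont.isOpen_inter_preimage hU isOpen_compl_singleton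
  have hcd (x : E) (hx : x ∈ N) : HasFDerivAt c (0 : E →L[ℝ] E) x := by
    have hwx := (hw x hx.1).hasFDerivAt
    have hne : ‖w x‖ ^ 2 ≠ 0 := by simpa using hx.2
    have h := (hasFDerivAt_id x).add ((((hasDerivAt_inv hne).comp_hasFDerivAt x
      hwx.norm_sq).const_mul 2).smul hwx)
    refine h.congr_fderiv ?_
    ext y
    simp [hw' x hx.1, inner_sub_right, inner_smul_right]
    have : ‖w x‖ ≠ 0 := by simpa using hne
    match_scalars <;> field_simp <;> ring
  have hmem (a x : E) (hx : x ∈ U) : (x ∈ N ∧ c x = a) ↔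
      x ∈ U ∧ ‖x - a‖ * ‖w x‖ = 2 ∧ ‖x - a‖ ^ 2 • w x = (-2 : ℝ) • (x - a) := by
    constructor
    · rintro ⟨hxN, rfl⟩
      have hne : ‖w x‖ ≠ 0 := by simpa using hxN.2
      have hsub : x - c x = (-2 * (‖w x‖ ^ 2)⁻¹) • w x := by simp only [c]; module
      have hnorm : ‖x - c x‖ = 2 * (‖w x‖)⁻¹ := by
        rw [hsub, norm_smul]
        simp
        field_simp
      refine ⟨hx, by rw [hnorm]; field_simp, ?_⟩
      rw [hnorm, hsub, smul_smul]
      congr 1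
      field_simp
    · rintro ⟨-, h₁, h₂⟩
      have hne : ‖w x‖ ≠ 0 := fun h => by simp [h] at h₁
      refine ⟨⟨hx, by simpa using hne⟩, ?_⟩
      have h₃ : (4 : ℝ) • w x = (-2 * ‖w x‖ ^ 2) • (x - a) := by
        rw [show (4 : ℝ) = ‖w x‖ ^ 2 * ‖x - a‖ ^ 2 by rw [← mul_pow, mul_comm, h₁]; norm_num,
          mul_smul, h₂, smul_smul, mul_comm]
      have h₄ : x - a = (-2 * (‖w x‖ ^ 2)⁻¹) • w x := by
        have := congrArg (fun v => (-(2 * ‖w x‖ ^ 2)⁻¹) • v) h₃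
        simp only [smul_smul] at this
        rw [show -(2 * ‖w x‖ ^ 2)⁻¹ * (-2 * ‖w x‖ ^ 2) = 1 by field_simp, one_smul] at this
        rw [← this]
        congr 1
        field_simp
        norm_num
      simp only [c]
      linear_combination (norm := module) h₄
  let a := c x₀
  let T : Set E := {x | x ∈ N ∧ c x = a}
  have hTopen : IsOpen T :=
    hN.isOpen_inter_preimage_of_fderiv_eq_zero
      (fun x hx => (hcd x hx).differentiableAt.differentiableWithinAt)
      (fun x hx => (hcd x hx).fderiv) {a}
  have hTclosed : closure T ∩ U ⊆ T := by
    rintro x ⟨hxT, hx⟩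
    refine (hmem a x hx).mpr ⟨hx, ?_⟩
    have hwx := (hw x hx).continuousAt
    let φ : E → ℝ × E := fun x => (‖x - a‖ * ‖w x‖, ‖x - a‖ ^ 2 • w x - (-2 : ℝ) • (x - a))
    have hφ : ContinuousAt φ x := by fun_prop
    have hmaps : Set.MapsTo φ T {(2, 0)} := fun p hp => by
      obtain ⟨-, h₁, h₂⟩ := (hmem a p hp.1.1).mp hp
      simp [φ, h₁, h₂]
    have h := hφ.continuousWithinAt.mem_closure hxT hmaps
    rw [closure_singleton, Set.mem_singleton_iff, Prod.mk.injEq, sub_eq_zero] at h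
    exact h
  have hsub : U ⊆ T := hconn.subset_of_closure_inter_subset hTopen
    ⟨x₀, hx₀, ⟨hx₀, hwx₀⟩, rfl⟩ hTclosed
  refine ⟨a, fun ha => ?_, fun x hx => ((hmem a x hx).mp (hsub hx)).2.2⟩
  simpa using ((hmem a a ha).mp (hsub ha)).2.1

/-- The inversion centred at `a` followed by a linear map `B` has differential
`‖x - a‖ ^ (-2) • B ∘ R`, with `R` the reflection in the hyperplane orthogonal to `x - a`. -/
theorem hasFDerivAt_inversion {E : Type*} [NormedAddCommGroup E] [InnerProductSpace ℝ E]
    (B : E →L[ℝ] E) {a x : E} (hx : x ≠ a) :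
    ∃ L : E →L[ℝ] E, HasFDerivAt (fun x => (‖x - a‖ ^ 2)⁻¹ • B (x - a)) L x ∧
      ∀ v, L v = (‖x - a‖ ^ 2)⁻¹ • B v
        - (2 * ⟪x - a, v⟫_ℝ * ((‖x - a‖ ^ 2)⁻¹ * (‖x - a‖ ^ 2)⁻¹)) • B (x - a) := by
  have hne : ‖x - a‖ ^ 2 ≠ 0 := by simpa [sub_eq_zero] using hx
  have hid : HasFDerivAt (fun x : E => x - a) (ContinuousLinearMap.id ℝ E) x :=
    (hasFDerivAt_id x).sub_const a
  refine ⟨_, ((hasDerivAt_inv hne).comp_hasFDerivAt x hid.norm_sq).smul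
    (B.hasFDerivAt.comp x hid), fun v => ?_⟩
  simp [-map_sub]
  module

theorem eqOn_affine_of_logConformalGradient_eq_zero {E : Type*} [NormedAddCommGroup E]
    [InnerProductSpace ℝ E] [FiniteDimensional ℝ E] {f : E → E} {e x₀ : E} {U : Set E}
    (hU : IsOpen U) (hconn : IsPreconnected U) (he : ‖e‖ = 1) (hf : ContDiffOn ℝ (⊤ : ℕ∞) f U)
    (hc : ∀ x ∈ U, ConformalAt f x) (hx₀ : x₀ ∈ U)
    (hw : ∀ x ∈ U, logConformalGradient f e x = 0) {x : E} (hx : x ∈ U) :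
    f x = f x₀ + fderiv ℝ f x₀ (x - x₀) := by
  have hfx (x : E) (hx : x ∈ U) := hf.contDiffAt (hU.mem_nhds hx)
  have hF (x : E) (hx : x ∈ U) : DifferentiableAt ℝ (fderiv ℝ f) x :=
    (hfx x hx).fderiv_infty.differentiableAt (by simp)
  have hconst {x : E} (hx : x ∈ U) : fderiv ℝ f x = fderiv ℝ f x₀ := by
    refine hU.is_const_of_fderiv_eq_zero hconn
      (fun x hx => (hF x hx).differentiableWithinAt) (fun x hx => ?_) hx hx₀
    ext u v : 2
    rw [fderiv_fderiv_of_conformal hU he hf hc hx, hw x hx]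
    simp [conformalConnection]
  have hd (x : E) (hx : x ∈ U) :
      HasFDerivAt (fun x => f x - fderiv ℝ f x₀ (x - x₀)) (0 : E →L[ℝ] E) x := by
    have h := ((hfx x hx).differentiableAt (by simp)).hasFDerivAt.sub
      ((fderiv ℝ f x₀).hasFDerivAt.comp x ((hasFDerivAt_id x).sub_const x₀))
    refine h.congr_fderiv ?_
    rw [hconst hx]
    simp
  have h := hU.is_const_of_fderiv_eq_zero hconn
    (fun x hx => (hd x hx).differentiableAt.differentiableWithinAt)
    (fun x hx => (hd x hx).fderiv) hx hx₀
  simp only [sub_self, map_zero, sub_zero] at h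
  exact sub_eq_iff_eq_add.mp h

theorem exists_eqOn_inversion_of_logConformalGradient {E : Type*} [NormedAddCommGroup E]
    [InnerProductSpace ℝ E] [FiniteDimensional ℝ E] {f : E → E} {e a x₀ : E} {U : Set E}
    (hU : IsOpen U) (hconn : IsPreconnected U) (he : ‖e‖ = 1) (hf : ContDiffOn ℝ (⊤ : ℕ∞) f U)
    (hc : ∀ x ∈ U, ConformalAt f x) (hx₀ : x₀ ∈ U) (ha : a ∉ U)
    (hw : ∀ x ∈ U, ‖x - a‖ ^ 2 • logConformalGradient f e x = (-2 : ℝ) • (x - a)) :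
    ∃ (b : E) (B : E →L[ℝ] E), IsConformalMap B ∧
      ∀ x ∈ U, f x = b + (‖x - a‖ ^ 2)⁻¹ • B (x - a) := by
  have hfx (x : E) (hx : x ∈ U) := hf.contDiffAt (hU.mem_nhds hx)
  have hF (x : E) (hx : x ∈ U) : DifferentiableAt ℝ (fderiv ℝ f) x :=
    (hfx x hx).fderiv_infty.differentiableAt (by simp)
  have hxa (x : E) (hx : x ∈ U) : x ≠ a := fun h => ha (h ▸ hx)
  have hne (x : E) (hx : x ∈ U) : ‖x - a‖ ^ 2 ≠ 0 := by simpa [sub_eq_zero] using hxa x hx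
  let B : E → E →L[ℝ] E := fun x => ‖x - a‖ ^ 2 • fderiv ℝ f x
    - (2 : ℝ) • (innerSL ℝ (x - a)).smulRight (fderiv ℝ f x (x - a))
  have hBapp (x v : E) : B x v = ‖x - a‖ ^ 2 • fderiv ℝ f x v
      - (2 : ℝ) • ⟪x - a, v⟫_ℝ • fderiv ℝ f x (x - a) := by simp [B, -map_sub]
  have hconst (x : E) (hx : x ∈ U) : B x = B x₀ := by
    ext v
    have hd (x : E) (hx : x ∈ U) : HasFDerivAt (fun x => B x v) (0 : E →L[ℝ] E) x := by
      have hid : HasFDerivAt (fun x : E => x - a) (ContinuousLinearMap.id ℝ E) x :=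
        (hasFDerivAt_id x).sub_const a
      have hFx := (hF x hx).hasFDerivAt
      have h := (hid.norm_sq.smul (hFx.clm_apply (hasFDerivAt_const v x))).sub
        (((hid.inner ℝ (hasFDerivAt_const v x)).smul (hFx.clm_apply hid)).const_smul (2 : ℝ))
      refine (h.congr_of_eventuallyEq (.of_forall fun x => hBapp x v)).congr_fderiv ?_
      ext z
      have hM (u : E) : ‖x - a‖ ^ 2 • conformalConnection (logConformalGradient f e x) z u =
          (-2 : ℝ) • conformalConnection (x - a) z u := by
        have h (u : E) : ‖x - a‖ ^ 2 * ⟪logConformalGradient f e x, u⟫_ℝ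
            = -2 * ⟪x - a, u⟫_ℝ := by
          simpa [inner_smul_left] using congrArg (fun p => ⟪p, u⟫_ℝ) (hw x hx)
        simp only [conformalConnection, smul_add, smul_sub, smul_smul, h,
          mul_comm _ ⟪z, u⟫_ℝ]
        rw [mul_smul ⟪z, u⟫_ℝ, hw x hx]
        module
      have hMx : conformalConnection (logConformalGradient f e x) z (x - a) = (-2 : ℝ) • z := by
        refine smul_right_injective E (hne x hx) ?_
        change _ • _ = _ • _
        rw [hM]
        simp only [conformalConnection, real_inner_self_eq_norm_sq, real_inner_comm z]
        module
      have hMv := congrArg (fderiv ℝ f x) (hM v)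
      simp only [map_smul] at hMv
      simp [fderiv_fderiv_of_conformal hU he hf hc hx, hMv, hMx, -map_sub]
      have hexpand (p : E) : fderiv ℝ f x (conformalConnection p z v) =
          ⟪p, z⟫_ℝ • fderiv ℝ f x v + ⟪p, v⟫_ℝ • fderiv ℝ f x z - ⟪z, v⟫_ℝ • fderiv ℝ f x p := by
        simp [conformalConnection]
      rw [hexpand]
      module
    exact hU.is_const_of_fderiv_eq_zero hconn
      (fun x hx => (hd x hx).differentiableAt.differentiableWithinAt)
      (fun x hx => (hd x hx).fderiv) hx hx₀
  have hBconf : IsConformalMap (B x₀) := by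
    obtain ⟨c, hc0, hcx⟩ := conformalAt_iff'.mp (hc x₀ hx₀)
    have hpos : 0 < ‖x₀ - a‖ ^ 2 := (sq_nonneg _).lt_of_ne' (hne x₀ hx₀)
    refine isConformalMap_iff _ |>.mpr ⟨(‖x₀ - a‖ ^ 2) ^ 2 * c, by positivity, fun u v => ?_⟩
    simp only [hBapp]
    generalize x₀ - a = r
    simp only [inner_sub_left, inner_sub_right, inner_smul_left, inner_smul_right, hcx,
      conj_trivial, real_inner_self_eq_norm_sq, real_inner_comm r]
    ring
  have hd (x : E) (hx : x ∈ U) :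
      HasFDerivAt (fun x => f x - (‖x - a‖ ^ 2)⁻¹ • B x₀ (x - a)) (0 : E →L[ℝ] E) x := by
    obtain ⟨L, hL, hLapp⟩ := hasFDerivAt_inversion (B x₀) (hxa x hx)
    refine (((hfx x hx).differentiableAt (by simp)).hasFDerivAt.sub hL).congr_fderiv ?_
    ext v
    rw [sub_apply, hLapp, ← hconst x hx, hBapp, hBapp, real_inner_self_eq_norm_sq]
    have : ‖x - a‖ ≠ 0 := by simpa using hne x hx
    simp only [smul_sub, smul_smul, zero_apply]
    match_scalars <;> field_simp <;> ring
  refine ⟨f x₀ - (‖x₀ - a‖ ^ 2)⁻¹ • B x₀ (x₀ - a), B x₀, hBconf, fun x hx => ?_⟩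
  exact sub_eq_iff_eq_add.mp (hU.is_const_of_fderiv_eq_zero hconn
    (fun x hx => (hd x hx).differentiableAt.differentiableWithinAt)
    (fun x hx => (hd x hx).fderiv) hx hx₀)

/-- **Liouville's theorem** on conformal maps of Euclidean spaces of dimension at least three. -/
theorem exists_moebius_of_conformal {E : Type*} [NormedAddCommGroup E] [InnerProductSpace ℝ E]
    [FiniteDimensional ℝ E] (hdim : 3 ≤ Module.finrank ℝ E) {U : Set E} (hU : IsOpen U)
    (hconn : IsConnected U) {f : E → E} (hf : ContDiffOn ℝ (⊤ : ℕ∞) f U)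
    (hc : ∀ x ∈ U, ConformalAt f x) :
    ∃ (a b : E) (α : ℝ) (_ : α ≠ 0) (A : E ≃ₗᵢ[ℝ] E) (inv : Bool), (inv = true → a ∉ U) ∧
      ∀ x ∈ U, f x = b + (if inv then α / ‖x - a‖ ^ 2 else α) • A (x - a) := by
  obtain ⟨x₀, hx₀⟩ := hconn.nonempty
  obtain ⟨e, -, he, -⟩ := exists_orthonormal_pair_orthogonal hdim 0
  replace he : ‖e‖ = 1 := by simpa [real_inner_self_eq_norm_sq, pow_eq_one_iff_of_nonneg] using he
  rcases eq_zero_or_exists_center hU hconn.isPreconnected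
    (fun x hx => (contDiffAt_logConformalGradient he (hf.contDiffAt (hU.mem_nhds hx))
      (hc x hx)).differentiableAt (by simp))
    (fun x hx y => fderiv_logConformalGradient hdim hU he hf hc hx y) with hw | ⟨a, ha, hw⟩
  · obtain ⟨L, hL, hLconf⟩ := hc x₀ hx₀
    obtain ⟨α, hα, A, hA⟩ := hLconf.exists_linearIsometryEquiv
    refine ⟨x₀, f x₀, α, hα, A, false, by simp, fun x hx => ?_⟩
    rw [eqOn_affine_of_logConformalGradient_eq_zero hU hconn.isPreconnected he hf hc hx₀ hw hx,
      hL.fderiv, hA]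
    simp
  · obtain ⟨b, B, hB, hfB⟩ := exists_eqOn_inversion_of_logConformalGradient hU
      hconn.isPreconnected he hf hc hx₀ ha hw
    obtain ⟨α, hα, A, hA⟩ := hB.exists_linearIsometryEquiv
    refine ⟨a, b, α, hα, A, true, fun _ => ha, fun x hx => ?_⟩
    rw [hfB x hx, hA, smul_smul, if_pos rfl, div_eq_inv_mul]

end Liouville


/-- Liouville's theorem: every smooth conformal map on a
connected open subset of ℝ^{2n} (n ≥ 2) is the restriction of a Möbius
transformation x ↦ b + (α or α/‖x−a‖²)·A(x−a), a composition of translations,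
orthogonal maps, dilations, and at most one inversion. -/
theorem stmt17 (n : ℕ) (hn : 2 ≤ n)
    (U : Set (EuclideanSpace ℝ (Fin (2 * n))))
    (hUopen : IsOpen U) (hUconn : IsConnected U)
    (f : EuclideanSpace ℝ (Fin (2 * n)) → EuclideanSpace ℝ (Fin (2 * n)))
    (hsmooth : ContDiffOn ℝ (⊤ : ℕ∞) f U)
    (hconf : ∀ x ∈ U, ConformalAt f x) :
    ∃ (a b : EuclideanSpace ℝ (Fin (2 * n))) (α : ℝ) (_ : α ≠ 0)
      (A : EuclideanSpace ℝ (Fin (2 * n)) ≃ₗᵢ[ℝ] EuclideanSpace ℝ (Fin (2 * n)))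
      (inv : Bool),
      (inv = true → a ∉ U) ∧
        ∀ x ∈ U, f x
          = b + (if inv then α / ‖x - a‖ ^ 2 else α) • A (x - a) := by
  exact exists_moebius_of_conformal (by simp; omega) hUopen hUconn hsmooth hconf
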